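/- arXiv:1710.00430 — 2 statements merged into one kernel-verified Lean document; each statement's English description precedes it below -/
import Mathlib

section
/- For every θ with 0 < θ < π/2 and every ε > 0 there exists n₀ such that for all n ≥ n₀ the following holds: if A is a finite set of unit vectors in Euclidean space ℝⁿ such that ⟨u, v⟩ ≤ cos θ for all distinct u, v ∈ A (i.e. the angle between any two distinct vectors of A is at least θ), then (1/n)·log₂(#A) ≤ g(θ) + ε, where g(θ) = ((1+s)/(2s))·log₂((1+s)/(2s)) − ((1−s)/(2s))·log₂((1−s)/(2s)) and s = sin θ. -/
open scoped RealInnerProductSpace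

namespace KL
open MvPolynomial Finset

/-- Recurrence coefficients of the monic Gegenbauer polynomials. -/
noncomputable def bc (n k : ℕ) : ℝ :=
  ((k : ℝ) * (k + n - 3)) / ((2 * k + n - 2) * (2 * k + n - 4))

/-- Monic Gegenbauer polynomials (as functions). -/
noncomputable def gp (n : ℕ) : ℕ → ℝ → ℝ
  | 0, _ => 1
  | 1, t => t
  | (k + 2), t => t * gp n (k + 1) t - bc n (k + 1) * gp n k t

variable {n : ℕ}

noncomputable def TT (y : Fin n → ℝ) : MvPolynomial (Fin n) ℝ := ∑ i, C (y i) * X i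
noncomputable def NN (n : ℕ) : MvPolynomial (Fin n) ℝ := ∑ i, X i ^ 2

noncomputable def ZZ (y : Fin n → ℝ) : ℕ → MvPolynomial (Fin n) ℝ
  | 0 => 1
  | 1 => TT y
  | (k + 2) => TT y * ZZ y (k + 1) - C (bc n (k + 1)) * (NN n * ZZ y k)

noncomputable def DD (y : Fin n → ℝ) (q : MvPolynomial (Fin n) ℝ) : MvPolynomial (Fin n) ℝ :=
  ∑ i, C (y i) * pderiv i q
noncomputable def LL (q : MvPolynomial (Fin n) ℝ) : MvPolynomial (Fin n) ℝ :=
  ∑ i, pderiv i (pderiv i q)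

lemma TT_hom (y : Fin n → ℝ) : (TT y).IsHomogeneous 1 := by
  apply IsHomogeneous.sum
  intro i _
  simpa using (isHomogeneous_C (Fin n) (y i)).mul (isHomogeneous_X ℝ i)

lemma NN_hom : (NN n).IsHomogeneous 2 := by
  apply IsHomogeneous.sum
  intro i _
  simpa using (isHomogeneous_X ℝ i).pow 2

lemma ZZ_hom (y : Fin n → ℝ) : ∀ k, (ZZ y k).IsHomogeneous k
  | 0 => by simpa [ZZ] using isHomogeneous_one (Fin n) ℝ
  | 1 => by simpa [ZZ] using TT_hom y
  | (k + 2) => by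
    rw [ZZ]
    apply IsHomogeneous.sub
    · have := (TT_hom y).mul (ZZ_hom y (k + 1))
      rwa [show 1 + (k + 1) = k + 2 by ring] at this
    · have := (isHomogeneous_C (Fin n) (bc n (k + 1))).mul (NN_hom.mul (ZZ_hom y k))
      rwa [show 0 + (2 + k) = k + 2 by ring] at this

lemma pderiv_TT (y : Fin n → ℝ) (i : Fin n) : pderiv i (TT y) = C (y i) := by
  simp [TT, pderiv_X, Pi.single_apply]

lemma pderiv_NN (i : Fin n) : pderiv i (NN n) = 2 * X i := by
  simp [NN, pderiv_X, Pi.single_apply]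

lemma DD_mul (y : Fin n → ℝ) (p q : MvPolynomial (Fin n) ℝ) :
    DD y (p * q) = DD y p * q + p * DD y q := by
  simp only [DD, pderiv_mul, Finset.sum_mul, Finset.mul_sum, ← Finset.sum_add_distrib]
  exact Finset.sum_congr rfl fun i _ => by ring

lemma DD_sub (y : Fin n → ℝ) (p q : MvPolynomial (Fin n) ℝ) :
    DD y (p - q) = DD y p - DD y q := by
  simp only [DD, map_sub, mul_sub, Finset.sum_sub_distrib]

lemma DD_C (y : Fin n → ℝ) (a : ℝ) : DD y (C a) = 0 := by simp [DD]

lemma DD_TT (y : Fin n → ℝ) (hy : ∑ i, y i ^ 2 = 1) : DD y (TT y) = 1 := by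
  have h := congrArg (C (σ := Fin n)) hy
  rw [map_sum, C_1] at h
  rw [← h]
  simp only [DD, pderiv_TT, C_mul, pow_two]

lemma DD_NN (y : Fin n → ℝ) : DD y (NN n) = 2 * TT y := by
  simp only [DD, pderiv_NN, TT, Finset.mul_sum]
  exact Finset.sum_congr rfl fun i _ => by ring

lemma LL_sub (p q : MvPolynomial (Fin n) ℝ) : LL (p - q) = LL p - LL q := by
  simp only [LL, map_sub, Finset.sum_sub_distrib]

lemma LL_C_mul (a : ℝ) (q : MvPolynomial (Fin n) ℝ) : LL (C a * q) = C a * LL q := by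
  simp only [LL, pderiv_C_mul, Finset.mul_sum]

lemma LL_TT_mul (y : Fin n → ℝ) (q : MvPolynomial (Fin n) ℝ) :
    LL (TT y * q) = 2 * DD y q + TT y * LL q := by
  simp only [LL, DD, pderiv_mul, pderiv_TT, map_add, pderiv_C, Finset.mul_sum,
    ← Finset.sum_add_distrib]
  exact Finset.sum_congr rfl fun i _ => by ring

lemma LL_NN_mul (q : MvPolynomial (Fin n) ℝ) :
    LL (NN n * q) = 2 * (n : MvPolynomial (Fin n) ℝ) * q + 4 * ∑ i, X i * pderiv i q + NN n * LL q := by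
  have h2 : ∀ i : Fin n, pderiv i (2 : MvPolynomial (Fin n) ℝ) = 0 := fun i => by
    exact pderiv_C (R := ℝ) (a := 2) (i := i)
  have hn : 2 * (n : MvPolynomial (Fin n) ℝ) * q = ∑ i : Fin n, 2 * q := by
    simp; ring
  rw [hn]
  simp only [LL, pderiv_mul, pderiv_NN, map_add, pderiv_X_self, h2, Finset.mul_sum,
    ← Finset.sum_add_distrib]
  exact Finset.sum_congr rfl fun i _ => by ring

lemma euler (k : ℕ) (q : MvPolynomial (Fin n) ℝ) (h : q.IsHomogeneous k) :
    ∑ i, X i * pderiv i q = (k : MvPolynomial (Fin n) ℝ) * q := by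
  rw [h.sum_X_mul_pderiv, nsmul_eq_mul]

lemma ZZ_rel (hn : 5 ≤ n) (y : Fin n → ℝ) (hy : ∑ i, y i ^ 2 = 1) (k : ℕ) :
    DD y (ZZ y (k + 1)) = C (bc n (k + 1) * (n + 2 * (k + 1) - 2)) * ZZ y k ∧
    DD y (ZZ y (k + 2)) = C (bc n (k + 2) * (n + 2 * (k + 2) - 2)) * ZZ y (k + 1) ∧
    LL (ZZ y k) = 0 ∧ LL (ZZ y (k + 1)) = 0 := by
  have hn' : (5 : ℝ) ≤ n := by exact_mod_cast hn
  induction k with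
  | zero =>
    have hb : bc n 1 * n = 1 := by
      simp only [bc]; push_cast; field_simp
      rw [div_eq_one_iff_eq]
      · ring
      · have : (n:ℝ) - 2 > 0 := by linarith
        ring_nf; nlinarith
    have h1 : DD y (ZZ y 1) = 1 := DD_TT y hy
    have e : bc n 2 * (n + 2 * 2 - 2) = 2 - 2 * bc n 1 := by
      simp only [bc]; push_cast
      have : (n:ℝ) - 2 > 0 := by linarith
      have h3: (n:ℝ) + 2 > 0 := by linarith
      have h4: (n:ℝ) > 0 := by linarith
      rw [show (2 * 2 + (n:ℝ) - 2) = n + 2 by ring, show (2 * 2 + (n:ℝ) - 4) = n by ring,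
        show (2 * 1 + (n:ℝ) - 2) = n by ring, show (2 * 1 + (n:ℝ) - 4) = n - 2 by ring]
      field_simp
      ring
    refine ⟨?_, ?_, ?_, ?_⟩
    · rw [zero_add, h1]
      simp [ZZ, hb]
    · simp only [zero_add]
      have hZ : ZZ y 2 = TT y * ZZ y 1 - C (bc n 1) * (NN n * ZZ y 0) := rfl
      rw [hZ, DD_sub, DD_mul, DD_mul, DD_mul, DD_C, DD_NN, DD_TT y hy, h1]
      have : DD y (ZZ y 0) = 0 := by simp [ZZ, DD]
      rw [this]
      have e' := congrArg (C (σ := Fin n)) e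
      push_cast
      rw [show ((n:ℝ) + 2 * (0 + 2) - 2) = n + 2 * 2 - 2 by ring, e']
      simp only [ZZ, map_sub, map_mul, show (C 2 : MvPolynomial (Fin n) ℝ) = 2 from rfl]
      ring
    · simp [ZZ, LL]
    · simp [ZZ, LL, pderiv_TT]
  | succ k ih =>
    obtain ⟨h1, h2, h3, h4⟩ := ih
    have hk : (0:ℝ) ≤ k := by positivity
    refine ⟨?_, ?_, ?_, ?_⟩
    · rw [h2]; push_cast; ring_nf
    · have e1 : bc n (k + 3) * (n + 2 * (k + 3) - 2) = 1 + bc n (k + 2) * (n + 2 * (k + 2) - 4) := by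
        simp only [bc]; push_cast
        rw [show (2 * ((k:ℝ) + 3) + n - 2) = 2 * k + n + 4 by ring,
          show (2 * ((k:ℝ) + 3) + n - 4) = 2 * k + n + 2 by ring,
          show (2 * ((k:ℝ) + 2) + n - 2) = 2 * k + n + 2 by ring,
          show (2 * ((k:ℝ) + 2) + n - 4) = 2 * k + n by ring]
        have a1 : 2 * (k:ℝ) + n + 4 > 0 := by linarith
        have a2 : 2 * (k:ℝ) + n + 2 > 0 := by linarith
        have a3 : 2 * (k:ℝ) + n > 0 := by linarith
        field_simp
        ring
      have hZ : ZZ y (k + 2) = TT y * ZZ y (k + 1) - C (bc n (k + 1)) * (NN n * ZZ y k) := by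
        rw [ZZ]
      have e1' := congrArg (C (σ := Fin n)) e1
      rw [show k + 1 + 2 = (k + 1) + 2 from rfl, ZZ, DD_sub, DD_mul, DD_mul, DD_mul, DD_C, DD_NN,
        DD_TT y hy]
      rw [show k + 1 + 1 = k + 2 from rfl, show k + 1 + 2 = k + 3 from rfl, h1, h2]
      push_cast
      rw [show ((k:ℝ) + 1 + 2) = k + 3 by ring, e1', hZ]
      simp only [map_add, map_sub, map_mul, C_1]
      simp only [show (C 2 : MvPolynomial (Fin n) ℝ) = 2 from rfl, show (C 4 : MvPolynomial (Fin n) ℝ) = 4 from rfl]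
      ring
    · exact h4
    · rw [show k + 1 + 1 = k + 2 from rfl, ZZ, LL_sub, LL_C_mul, LL_TT_mul, LL_NN_mul, h3, h4,
        euler k _ (ZZ_hom y k), h1]
      simp only [map_add, map_sub, map_mul, C_1, map_natCast]
      simp only [show (C 2 : MvPolynomial (Fin n) ℝ) = 2 from rfl]
      ring

lemma ZZ_decomp (y : Fin n → ℝ) : ∀ k, ∃ h, ZZ y k = TT y ^ k + NN n * h
  | 0 => ⟨0, by simp [ZZ]⟩
  | 1 => ⟨0, by simp [ZZ]⟩
  | (k + 2) => by
    obtain ⟨h, hh⟩ := ZZ_decomp y (k + 1)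
    refine ⟨TT y * h - C (bc n (k + 1)) * ZZ y k, ?_⟩
    rw [ZZ, hh]; ring

lemma ZZ_eval (y v : Fin n → ℝ) (hv : ∑ i, v i ^ 2 = 1) :
    ∀ k, eval v (ZZ y k) = gp n k (∑ i, y i * v i)
  | 0 => by simp [ZZ, gp]
  | 1 => by simp [ZZ, gp, TT]
  | (k + 2) => by
    have h1 : eval v (TT y) = ∑ i, y i * v i := by simp [TT]
    have h2 : eval v (NN n) = 1 := by simp [NN, hv]
    rw [ZZ, gp, map_sub, map_mul, map_mul, map_mul, ZZ_eval y v hv (k + 1), ZZ_eval y v hv k, h1, h2]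
    simp

/-- multi-index factorial -/
noncomputable def WW (a : Fin n →₀ ℕ) : ℝ := ∏ i, ((a i).factorial : ℝ)

/-- Fischer form -/
noncomputable def FF (q : MvPolynomial (Fin n) ℝ) : MvPolynomial (Fin n) ℝ →ₗ[ℝ] ℝ :=
  (basisMonomials (Fin n) ℝ).constr ℝ (fun a => WW a * coeff a q)

lemma FF_monomial (q : MvPolynomial (Fin n) ℝ) (a : Fin n →₀ ℕ) (r : ℝ) :
    FF q (monomial a r) = r * (WW a * coeff a q) := by
  have : monomial a r = r • basisMonomials (Fin n) ℝ a := by simp [smul_monomial]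
  rw [this, map_smul, FF, Module.Basis.constr_basis, smul_eq_mul]

lemma FF_X_mul (q p : MvPolynomial (Fin n) ℝ) (i : Fin n) :
    FF q (X i * p) = FF (pderiv i q) p := by
  induction p using MvPolynomial.induction_on' with
  | add p q hp hq => rw [mul_add, map_add, map_add, hp, hq]
  | monomial a r =>
    rw [X, monomial_mul, FF_monomial, FF_monomial, coeff_pderiv, add_comm (Finsupp.single i 1) a]
    have : WW (a + Finsupp.single i 1) = (a i + 1) * WW a := by
      unfold WW
      rw [← Finset.mul_prod_erase univ _ (mem_univ i),
        ← Finset.mul_prod_erase univ (fun j => ((a j).factorial : ℝ)) (mem_univ i), ← mul_assoc]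
      congr 1
      · simp [Nat.factorial_succ]
      · refine Finset.prod_congr rfl fun j hj => ?_
        have : j ≠ i := (Finset.mem_erase.mp hj).1
        simp [this.symm]
    rw [this]
    ring

lemma FF_add_left (q q' p : MvPolynomial (Fin n) ℝ) : FF (q + q') p = FF q p + FF q' p := by
  induction p using MvPolynomial.induction_on' with
  | add p q hp hq => rw [map_add, map_add, map_add, hp, hq]; ring
  | monomial a r => simp [FF_monomial]; ring

lemma FF_sum_left {ι : Type*} (s : Finset ι) (q : ι → MvPolynomial (Fin n) ℝ) (p) :
    FF (∑ i ∈ s, q i) p = ∑ i ∈ s, FF (q i) p := by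
  classical
  induction s using Finset.induction_on with
  | empty =>
    simp only [Finset.sum_empty]
    induction p using MvPolynomial.induction_on' with
    | add p q hp hq => rw [map_add, hp, hq]; ring
    | monomial a r => simp [FF_monomial]
  | insert a s h ih => rw [Finset.sum_insert h, Finset.sum_insert h, FF_add_left, ih]

lemma FF_C_mul_left (c : ℝ) (q p : MvPolynomial (Fin n) ℝ) : FF (C c * q) p = c * FF q p := by
  induction p using MvPolynomial.induction_on' with
  | add p q hp hq => rw [map_add, map_add, hp, hq]; ring
  | monomial a r => simp [FF_monomial]; ring

lemma FF_NN (q p : MvPolynomial (Fin n) ℝ) : FF q (NN n * p) = FF (LL q) p := by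
  rw [NN, LL, Finset.sum_mul, map_sum, FF_sum_left]
  refine Finset.sum_congr rfl fun i _ => ?_
  rw [pow_two, mul_assoc, FF_X_mul, FF_X_mul]

lemma FF_TT (v : Fin n → ℝ) (q p : MvPolynomial (Fin n) ℝ) : FF q (TT v * p) = FF (DD v q) p := by
  rw [TT, DD, Finset.sum_mul, map_sum, FF_sum_left]
  refine Finset.sum_congr rfl fun i _ => ?_
  rw [FF_C_mul_left, ← FF_X_mul, mul_assoc, ← smul_eq_C_mul, map_smul, smul_eq_mul]

lemma FF_pow (v : Fin n → ℝ) (k : ℕ) : ∀ q : MvPolynomial (Fin n) ℝ, q.IsHomogeneous k →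
    FF q (TT v ^ k) = k.factorial * eval v q := by
  induction k with
  | zero =>
    intro q hq
    rw [pow_zero, show (1 : MvPolynomial (Fin n) ℝ) = monomial 0 1 from rfl, FF_monomial]
    have : q = C (coeff 0 q) := by
      exact (totalDegree_eq_zero_iff_eq_C).1 (Nat.le_zero.mp hq.totalDegree_le)
    rw [this]
    simp [WW]
  | succ k ih =>
    intro q hq
    have hD : (DD v q).IsHomogeneous k := by
      apply IsHomogeneous.sum
      intro i _
      simpa using (isHomogeneous_C (Fin n) (v i)).mul (hq.pderiv (i := i))
    rw [pow_succ', FF_TT, ih _ hD]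
    have h := congrArg (eval v) (euler (k+1) q hq)
    have h2 : eval v (DD v q) = (k + 1) * eval v q := by
      simpa [DD] using h
    rw [h2, Nat.factorial_succ]; push_cast; ring

lemma FF_hom (k : ℕ) (q p : MvPolynomial (Fin n) ℝ) (hp : p.IsHomogeneous k) :
    FF q p = ∑ a ∈ finsuppAntidiag univ k, WW a * coeff a q * coeff a p := by
  conv_lhs => rw [p.as_sum]
  rw [map_sum]
  simp only [FF_monomial]
  rw [Finset.sum_subset (s₂ := finsuppAntidiag univ k)]
  · exact Finset.sum_congr rfl fun a _ => by ring
  · intro a ha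
    simp only [mem_finsuppAntidiag, subset_univ, and_true]
    rw [← Finsupp.degree_eq_sum]
    by_contra h
    exact (mem_support_iff.mp ha) (hp.coeff_eq_zero h)
  · intro a _ ha
    simp [notMem_support_iff.mp ha]

lemma gp_pd (hn : 5 ≤ n) (k : ℕ) : ∃ ψ : (Fin n →₀ ℕ) → EuclideanSpace ℝ (Fin n) → ℝ,
    ∀ u v : EuclideanSpace ℝ (Fin n), ‖u‖ = 1 → ‖v‖ = 1 →
      gp n k ⟪u, v⟫ = ∑ a ∈ finsuppAntidiag univ k, ψ a u * ψ a v := by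
  refine ⟨fun a u => √(WW a / k.factorial) * coeff a (ZZ u k), fun u v hu hv => ?_⟩
  have sq : ∀ w : EuclideanSpace ℝ (Fin n), ‖w‖ = 1 → ∑ i, w i ^ 2 = 1 := fun w hw => by
    have := EuclideanSpace.norm_sq_eq w
    rw [hw] at this
    simpa using this.symm
  obtain ⟨h, hh⟩ := ZZ_decomp (v : Fin n → ℝ) k
  have key : FF (ZZ u k) (ZZ v k) = k.factorial * gp n k ⟪u, v⟫ := by
    rw [hh, map_add, FF_NN, (ZZ_rel hn u (sq u hu) k).2.2.1, FF_pow _ _ _ (ZZ_hom _ k),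
      ZZ_eval _ _ (sq v hv)]
    have : FF (0 : MvPolynomial (Fin n) ℝ) h = 0 := by
      simpa using FF_sum_left (∅ : Finset ℕ) (fun _ => 0) h
    rw [this, add_zero]
    congr 2
    simp [PiLp.inner_apply, mul_comm]
  rw [FF_hom k _ _ (ZZ_hom _ k)] at key
  have hk : (k.factorial : ℝ) > 0 := by positivity
  have : gp n k ⟪u, v⟫ = (∑ a ∈ finsuppAntidiag univ k, WW a * coeff a (ZZ u k) * coeff a (ZZ v k)) / k.factorial := by
    rw [key]; field_simp
  rw [this, Finset.sum_div]
  refine Finset.sum_congr rfl fun a _ => ?_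
  have hW : 0 ≤ WW a / k.factorial := by unfold WW; positivity
  have := Real.mul_self_sqrt hW
  calc _ = (WW a / k.factorial) * coeff a (ZZ u k) * coeff a (ZZ v k) := by ring
    _ = _ := by rw [← this]; ring

lemma gp_one (hn : 5 ≤ n) (k : ℕ) : 0 < gp n k 1 ∧
    gp n (k + 1) 1 * (2 * k + n - 2) = (k + n - 2) * gp n k 1 := by
  have hn' : (5 : ℝ) ≤ n := by exact_mod_cast hn
  induction k with
  | zero => simp [gp]
  | succ k ih =>
    obtain ⟨h1, h2⟩ := ih
    have hk : (0:ℝ) ≤ k := by positivity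
    have a1 : (0:ℝ) < 2 * k + n - 2 := by linarith
    have a2 : (0:ℝ) < k + n - 2 := by linarith
    have a3 : (0:ℝ) < 2 * k + n := by linarith
    refine ⟨?_, ?_⟩
    · have : 0 < gp n (k + 1) 1 * (2 * k + n - 2) := by rw [h2]; positivity
      exact pos_of_mul_pos_left this a1.le
    · rw [show k + 1 + 1 = k + 2 from rfl, gp]
      have h3 : gp n k 1 = gp n (k + 1) 1 * (2 * k + n - 2) / (k + n - 2) := by
        rw [h2]; field_simp
      rw [h3, bc]
      push_cast
      rw [show (2 * ((k:ℝ) + 1) + n - 2) = 2 * k + n by ring,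
        show (2 * ((k:ℝ) + 1) + n - 4) = 2 * k + n - 2 by ring,
        show ((k:ℝ) + 1 + n - 3) = k + n - 2 by ring]
      generalize gp n (k + 1) 1 = g
      have a1' := a1.ne'
      have a2' := a2.ne'
      have e : ((k:ℝ) + 1) * (k + n - 2) / ((2 * k + n) * (2 * k + n - 2)) * (g * (2 * k + n - 2) / (k + n - 2))
          = (k + 1) * g / (2 * k + n) := by
        generalize (2 * (k:ℝ) + n - 2) = x at *
        generalize ((k:ℝ) + n - 2) = z at *
        field_simp
      rw [e]
      field_simp
      ring

lemma psum_sq_le {E β : Type*} (A : Finset E) (S : Finset β) (φ : β → E → ℝ) :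
    (∑ u ∈ A, ∑ b ∈ S, φ b u * φ b u) ^ 2 ≤
      (#S : ℝ) * ∑ u ∈ A, ∑ v ∈ A, (∑ b ∈ S, φ b u * φ b v) ^ 2 := by
  have h1 : ∑ u ∈ A, ∑ v ∈ A, (∑ b ∈ S, φ b u * φ b v) ^ 2 =
      ∑ b ∈ S, ∑ c ∈ S, (∑ u ∈ A, φ b u * φ c u) ^ 2 := by
    simp only [pow_two, Finset.sum_mul_sum]
    rw [Finset.sum_congr rfl fun u _ => Finset.sum_comm, Finset.sum_comm]
    refine Finset.sum_congr rfl fun b _ => ?_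
    rw [Finset.sum_congr rfl fun u _ => Finset.sum_comm, Finset.sum_comm]
    refine Finset.sum_congr rfl fun c _ => Finset.sum_congr rfl fun u _ =>
      Finset.sum_congr rfl fun v _ => ?_
    ring
  rw [h1, Finset.sum_comm]
  calc (∑ b ∈ S, ∑ u ∈ A, φ b u * φ b u) ^ 2
      ≤ (#S : ℝ) * ∑ b ∈ S, (∑ u ∈ A, φ b u * φ b u) ^ 2 := sq_sum_le_card_mul_sum_sq
    _ ≤ _ := by
      gcongr with b hb
      exact Finset.single_le_sum (f := fun c => (∑ u ∈ A, φ b u * φ c u) ^ 2)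
        (fun c _ => sq_nonneg _) hb

/-- positive definiteness of a function of the inner product on a finite set -/
def PD (A : Finset (EuclideanSpace ℝ (Fin n))) (g : ℝ → ℝ) : Prop :=
  ∀ x : EuclideanSpace ℝ (Fin n) → ℝ, 0 ≤ ∑ u ∈ A, ∑ v ∈ A, x u * x v * g ⟪u, v⟫

lemma PD.add {A : Finset (EuclideanSpace ℝ (Fin n))} {g h : ℝ → ℝ} (hg : PD A g) (hh : PD A h) :
    PD A (fun t => g t + h t) := fun x => by
  have := add_nonneg (hg x) (hh x)
  simpa only [mul_add, Finset.sum_add_distrib] using this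

lemma PD.smul {A : Finset (EuclideanSpace ℝ (Fin n))} {g : ℝ → ℝ} (hg : PD A g) {c : ℝ}
    (hc : 0 ≤ c) : PD A (fun t => c * g t) := fun x => by
  have := mul_nonneg hc (hg x)
  rw [Finset.mul_sum] at this
  simp only [Finset.mul_sum] at this
  refine this.trans_eq (Finset.sum_congr rfl fun u _ => Finset.sum_congr rfl fun v _ => ?_)
  ring

lemma PD.sum {A : Finset (EuclideanSpace ℝ (Fin n))} {g : ℕ → ℝ → ℝ} (m : ℕ)
    (hg : ∀ j < m, PD A (g j)) : PD A (fun t => ∑ j ∈ range m, g j t) := by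
  induction m with
  | zero => intro x; simp
  | succ m ih =>
    simp only [Finset.sum_range_succ]
    exact (ih fun j hj => hg j (by omega)).add (hg m (by omega))

lemma PD_gp (hn : 5 ≤ n) (A : Finset (EuclideanSpace ℝ (Fin n))) (hA : ∀ u ∈ A, ‖u‖ = 1) (k : ℕ) :
    PD A (gp n k) := fun x => by
  obtain ⟨ψ, hψ⟩ := gp_pd hn k
  have : ∑ u ∈ A, ∑ v ∈ A, x u * x v * gp n k ⟪u, v⟫ =
      ∑ a ∈ finsuppAntidiag univ k, (∑ u ∈ A, x u * ψ a u) ^ 2 := by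
    simp only [pow_two, Finset.sum_mul_sum]
    symm
    rw [Finset.sum_comm]
    refine Finset.sum_congr rfl fun u hu => ?_
    rw [Finset.sum_comm]
    refine Finset.sum_congr rfl fun v hv => ?_
    rw [hψ u v (hA u hu) (hA v hv), Finset.mul_sum]
    exact Finset.sum_congr rfl fun a _ => by ring
  rw [this]
  positivity

lemma telescoping (w P : ℕ → ℝ) (R L : ℝ) (h0 : w 0 = 0)
    (hw : ∀ j, w j + R * w (j + 2) = L * w (j + 1)) (M : ℕ) :
    ∑ j ∈ range M, w (j + 1) * (P (j + 2) + R * P j - L * P (j + 1)) =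
      w M * P (M + 1) - R * w (M + 1) * P M + R * w 1 * P 0 := by
  induction M with
  | zero => simp [h0]
  | succ M ih =>
    rw [Finset.sum_range_succ, ih]
    linear_combination P (M + 1) * hw M

lemma final_step {a d F s X c : ℝ} (ha : 0 < a) (hd : 0 < d) (hF : 0 < F) (hs : 0 ≤ s)
    (h1 : (a * F) ^ 2 ≤ s * X) (h2 : d * X ≤ a * ((1 - c) * F ^ 2)) : a * d ≤ (1 - c) * s := by
  have h5 : (a * F ^ 2) * (a * d) ≤ (a * F ^ 2) * ((1 - c) * s) := by
    calc (a * F ^ 2) * (a * d) = d * (a * F) ^ 2 := by ring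
      _ ≤ d * (s * X) := mul_le_mul_of_nonneg_left h1 hd.le
      _ = s * (d * X) := by ring
      _ ≤ s * (a * ((1 - c) * F ^ 2)) := mul_le_mul_of_nonneg_left h2 hs
      _ = _ := by ring
  exact le_of_mul_le_mul_left h5 (by positivity)

set_option maxHeartbeats 1000000 in
lemma main_bound (hn : 5 ≤ n) (l m : ℕ) (hm : 1 ≤ m) (r c : ℝ) (hr : 0 < r) (hc : c ≤ 1)
    (hb : ∀ j < m, r ^ 2 ≤ bc n (l + j + 1))
    (hcl : c < 2 * r * Real.cos (Real.pi / (m + 1)))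
    (A : Finset (EuclideanSpace ℝ (Fin n))) (hA : ∀ u ∈ A, ‖u‖ = 1)
    (hin : ∀ u ∈ A, ∀ v ∈ A, u ≠ v → ⟪u, v⟫ ≤ c) :
    (#A : ℝ) * (2 * r * Real.cos (Real.pi / (m + 1)) - c) ≤
      (1 - c) * ∑ j ∈ range m, (n.multichoose (l + j + 1) : ℝ) := by
  classical
  set L := 2 * r * Real.cos (Real.pi / (m + 1)) with hL
  set h := Real.pi / (m + 1) with hh
  have hm1 : (0:ℝ) < m + 1 := by positivity
  let w : ℕ → ℝ := fun j => Real.sin (j * h) / r ^ j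
  have hw0 : w 0 = 0 := by simp [w]
  have hwm : w (m + 1) = 0 := by
    have : ((m + 1 : ℕ) : ℝ) * h = Real.pi := by rw [hh]; push_cast; field_simp
    simp only [w, this, Real.sin_pi, zero_div]
  have hwrec : ∀ j, w j + r ^ 2 * w (j + 2) = L * w (j + 1) := fun j => by
    have e1 : Real.sin ((j : ℝ) * h) = Real.sin (((j + 1 : ℕ) : ℝ) * h - h) := by
      congr 1; push_cast; ring
    have e2 : Real.sin (((j + 2 : ℕ) : ℝ) * h) = Real.sin (((j + 1 : ℕ) : ℝ) * h + h) := by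
      congr 1; push_cast; ring
    simp only [w]
    rw [e1, e2, Real.sin_sub, Real.sin_add, hL]
    field_simp
    ring
  have hwpos : ∀ j, j ≤ m + 1 → 0 ≤ w j := fun j hj => by
    apply div_nonneg _ (by positivity)
    apply Real.sin_nonneg_of_nonneg_of_le_pi
    · have := Real.pi_pos; positivity
    · rw [hh, mul_div_assoc', div_le_iff₀ hm1, mul_comm]
      have : (j : ℝ) ≤ m + 1 := by exact_mod_cast hj
      have := Real.pi_pos
      gcongr
  have hw1 : 0 < w 1 := by
    apply div_pos _ (by positivity)
    apply Real.sin_pos_of_pos_of_lt_pi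
    · have := Real.pi_pos; positivity
    · rw [hh, Nat.cast_one, one_mul]
      apply div_lt_self Real.pi_pos
      have : (1:ℝ) ≤ m := by exact_mod_cast hm
      linarith
  let f : ℝ → ℝ := fun t => ∑ j ∈ range m, w (j + 1) * gp n (l + j + 1) t
  have hf1 : 0 < f 1 := by
    refine Finset.sum_pos' (fun j hj => ?_) ⟨0, Finset.mem_range.mpr (by omega), ?_⟩
    · exact mul_nonneg (hwpos _ (by have := Finset.mem_range.mp hj; omega)) (gp_one hn _).1.le
    · exact mul_pos hw1 (gp_one hn _).1
  have hN : PD A (fun t => t * f t - L * f t) := by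
    have e : (fun t => t * f t - L * f t) = fun t =>
        (∑ j ∈ range m, (w (j + 1) * (bc n (l + j + 1) - r ^ 2)) * gp n (l + j) t) +
        (w m * gp n (l + m + 1) t + (r ^ 2 * w 1) * gp n l t) := by
      funext t
      have ht := telescoping w (fun j => gp n (l + j) t) (r ^ 2) L hw0 hwrec m
      rw [hwm] at ht
      have : w m * gp n (l + m + 1) t + (r ^ 2 * w 1) * gp n l t =
         ∑ j ∈ range m, w (j + 1) * (gp n (l + (j + 2)) t + r ^ 2 * gp n (l + j) t - L * gp n (l + (j + 1)) t) := by
        rw [ht]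
        change _ = w m * gp n (l + m + 1) t - r ^ 2 * 0 * gp n (l + m) t + r ^ 2 * w 1 * gp n l t
        ring
      rw [this, ← Finset.sum_add_distrib]
      simp only [f]
      rw [Finset.mul_sum, Finset.mul_sum, ← Finset.sum_sub_distrib]
      refine Finset.sum_congr rfl fun j _ => ?_
      have hg : gp n (l + (j + 2)) t = t * gp n (l + j + 1) t - bc n (l + j + 1) * gp n (l + j) t := by
        rw [← add_assoc, gp]
      rw [hg, ← add_assoc]
      ring
    rw [e]
    refine PD.add (PD.sum m fun j hj => ?_) (PD.add ?_ ?_)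
    · exact (PD_gp hn A hA _).smul (mul_nonneg (hwpos _ (by omega)) (by linarith [hb j hj]))
    · exact (PD_gp hn A hA _).smul (hwpos _ (by omega))
    · exact (PD_gp hn A hA _).smul (by positivity)
  choose ψ hψ using fun k => gp_pd (n := n) hn k
  let S : Finset (Σ _ : ℕ, (Fin n →₀ ℕ)) := (range m).sigma fun j => finsuppAntidiag univ (l + j + 1)
  let φ : (Σ _ : ℕ, (Fin n →₀ ℕ)) → EuclideanSpace ℝ (Fin n) → ℝ := fun b u =>
    √(w (b.1 + 1)) * ψ (l + b.1 + 1) b.2 u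
  have hφ : ∀ u ∈ A, ∀ v ∈ A, f ⟪u, v⟫ = ∑ b ∈ S, φ b u * φ b v := by
    intro u hu v hv
    simp only [S, φ, f]
    rw [Finset.sum_sigma]
    refine Finset.sum_congr rfl fun j hj => ?_
    rw [hψ _ u v (hA u hu) (hA v hv), Finset.mul_sum]
    refine Finset.sum_congr rfl fun a _ => ?_
    have := Real.mul_self_sqrt (hwpos (j + 1) (by have := Finset.mem_range.mp hj; omega))
    simp only
    calc _ = (√(w (j + 1)) * √(w (j + 1))) * (ψ (l + j + 1) a u * ψ (l + j + 1) a v) := by rw [this]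
      _ = _ := by ring
  have hS : (#S : ℝ) = ∑ j ∈ range m, (n.multichoose (l + j + 1) : ℝ) := by
    simp only [S, Finset.card_sigma, card_finsuppAntidiag_nat_eq_multichoose, Finset.card_univ, Fintype.card_fin]
    push_cast
    rfl
  rw [← hS]
  have hself : ∀ u ∈ A, ⟪u, u⟫ = 1 := fun u hu => by
    rw [real_inner_self_eq_norm_sq, hA u hu]; norm_num
  -- trace inequality
  have h1 : ((#A : ℝ) * f 1) ^ 2 ≤ (#S : ℝ) * ∑ u ∈ A, ∑ v ∈ A, f ⟪u, v⟫ ^ 2 := by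
    have := psum_sq_le A S φ
    have e1 : ∑ u ∈ A, ∑ b ∈ S, φ b u * φ b u = #A * f 1 := by
      rw [Finset.sum_congr rfl fun u hu => (hφ u hu u hu).symm]
      rw [Finset.sum_congr rfl fun u hu => by rw [hself u hu]]
      simp
    rw [e1] at this
    refine this.trans_eq ?_
    congr 1
    exact Finset.sum_congr rfl fun u hu => Finset.sum_congr rfl fun v hv => by rw [hφ u hu v hv]
  have h2 : 0 ≤ ∑ u ∈ A, ∑ v ∈ A, (⟪u, v⟫ * f ⟪u, v⟫ - L * f ⟪u, v⟫) * f ⟪u, v⟫ := by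
    have : ∑ u ∈ A, ∑ v ∈ A, (⟪u, v⟫ * f ⟪u, v⟫ - L * f ⟪u, v⟫) * f ⟪u, v⟫ =
        ∑ b ∈ S, ∑ u ∈ A, ∑ v ∈ A, φ b u * φ b v * (⟪u, v⟫ * f ⟪u, v⟫ - L * f ⟪u, v⟫) := by
      symm
      rw [Finset.sum_comm]
      refine Finset.sum_congr rfl fun u hu => ?_
      rw [Finset.sum_comm]
      refine Finset.sum_congr rfl fun v hv => ?_
      rw [← Finset.sum_mul, ← hφ u hu v hv]
      ring
    rw [this]
    exact Finset.sum_nonneg fun b _ => hN (φ b)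
  have h3 : ∑ u ∈ A, ∑ v ∈ A, (⟪u, v⟫ - c) * f ⟪u, v⟫ ^ 2 ≤ #A * ((1 - c) * f 1 ^ 2) := by
    rw [← nsmul_eq_mul]
    refine Finset.sum_le_card_nsmul _ _ _ fun u hu => ?_
    rw [← Finset.add_sum_erase A _ hu, hself u hu]
    have : ∑ v ∈ A.erase u, (⟪u, v⟫ - c) * f ⟪u, v⟫ ^ 2 ≤ 0 := by
      refine Finset.sum_nonpos fun v hv => ?_
      obtain ⟨hne, hv⟩ := Finset.mem_erase.mp hv
      exact mul_nonpos_of_nonpos_of_nonneg (by linarith [hin u hu v hv hne.symm]) (sq_nonneg _)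
    linarith
  have h4 : (L - c) * ∑ u ∈ A, ∑ v ∈ A, f ⟪u, v⟫ ^ 2 ≤ ∑ u ∈ A, ∑ v ∈ A, (⟪u, v⟫ - c) * f ⟪u, v⟫ ^ 2 := by
    rw [← sub_nonneg, Finset.mul_sum, ← Finset.sum_sub_distrib]
    refine h2.trans_eq (Finset.sum_congr rfl fun u _ => ?_)
    rw [Finset.mul_sum, ← Finset.sum_sub_distrib]
    exact Finset.sum_congr rfl fun v _ => by ring
  have hlc : 0 < L - c := by linarith
  rcases Nat.eq_zero_or_pos (#A) with hA0 | hA0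
  · rw [hA0]
    simp only [Nat.cast_zero, zero_mul]
    exact mul_nonneg (by linarith) (by positivity)
  · have hApos : (0:ℝ) < #A := by exact_mod_cast hA0
    exact final_step hApos hlc hf1 (by positivity) h1 (h4.trans h3)

lemma bc_ge (hn : 5 ≤ n) (i : ℕ) (ρ : ℝ) (hρ : 0 < ρ) (hi : ρ * n ≤ i) :
    (1 - 1 / (1 + 2 * ρ) ^ 2) / 4 ≤ bc n i := by
  have hn' : (5 : ℝ) ≤ n := by exact_mod_cast hn
  have hi0 : (0:ℝ) ≤ i := by positivity
  have a1 : (0:ℝ) < 2 * i + n - 2 := by linarith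
  have a2 : (0:ℝ) < 2 * i + n - 4 := by linarith
  have e : bc n i = (1 - ((n - 2) / (2 * i + n - 2)) * ((n - 4) / (2 * i + n - 4))) / 4 := by
    have a1' := a1.ne'
    have a2' := a2.ne'
    rw [bc, div_mul_div_comm, eq_div_iff (by norm_num), eq_sub_iff_add_eq, div_mul_eq_mul_div,
      ← add_div, div_eq_one_iff_eq (mul_ne_zero a1' a2')]
    ring
  have hρ' : 0 < 1 + 2 * ρ := by linarith
  have b1 : ((n:ℝ) - 2) / (2 * i + n - 2) ≤ 1 / (1 + 2 * ρ) := by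
    rw [div_le_div_iff₀ a1 hρ']; nlinarith
  have b2 : ((n:ℝ) - 4) / (2 * i + n - 4) ≤ 1 / (1 + 2 * ρ) := by
    rw [div_le_div_iff₀ a2 hρ']; nlinarith
  have b3 : ((n - 2) / (2 * i + n - 2)) * ((n - 4) / (2 * i + n - 4)) ≤ 1 / (1 + 2 * ρ) * (1 / (1 + 2 * ρ)) := by
    apply mul_le_mul b1 b2 (div_nonneg (by linarith) a2.le) (by positivity)
  rw [e, show 1 / (1 + 2 * ρ) ^ 2 = 1 / (1 + 2 * ρ) * (1 / (1 + 2 * ρ)) by rw [pow_two]; field_simp]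
  linarith

/-- entropy-type exponent -/
noncomputable def en (ρ : ℝ) : ℝ := (1 + ρ) * Real.log (1 + ρ) - ρ * Real.log ρ

lemma multichoose_le (hn : 5 ≤ n) (i : ℕ) (ρ : ℝ) (hρ : 0 < ρ) (hi : i ≤ ρ * n) :
    (n.multichoose i : ℝ) ≤ Real.exp (n * en ρ) := by
  rw [Nat.multichoose_eq]
  have h0 : ((n + i - 1).choose i : ℝ) ≤ (n + i).choose i := by
    exact_mod_cast Nat.choose_le_choose i (by omega)
  refine h0.trans ?_
  have hx : (0:ℝ) < ρ / (1 + ρ) := by positivity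
  have hy : (0:ℝ) < 1 / (1 + ρ) := by positivity
  have h1 : (ρ / (1 + ρ)) ^ i * (1 / (1 + ρ)) ^ n * ((n + i).choose i : ℝ) ≤ 1 := by
    have := add_pow (ρ / (1 + ρ)) (1 / (1 + ρ)) (n + i)
    have e : ρ / (1 + ρ) + 1 / (1 + ρ) = 1 := by field_simp; ring
    rw [e, one_pow] at this
    refine le_of_le_of_eq ?_ this.symm
    have h := Finset.single_le_sum (s := range (n + i + 1)) (f := fun k => (ρ / (1 + ρ)) ^ k * (1 / (1 + ρ)) ^ (n + i - k) * ((n + i).choose k : ℝ))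
      (fun k _ => by positivity) (show i ∈ range (n + i + 1) by simp)
    simpa using h
  have hl : Real.log (ρ / (1 + ρ)) ≤ 0 := Real.log_nonpos hx.le (by rw [div_le_one (by positivity)]; linarith)
  have h2 : Real.exp (-(n * en ρ)) ≤ (ρ / (1 + ρ)) ^ i * (1 / (1 + ρ)) ^ n := by
    rw [← Real.exp_log hx, ← Real.exp_log hy, ← Real.exp_nat_mul, ← Real.exp_nat_mul, ← Real.exp_add]
    apply Real.exp_le_exp.mpr
    have h3 : (ρ * n) * Real.log (ρ / (1 + ρ)) ≤ i * Real.log (ρ / (1 + ρ)) :=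
      mul_le_mul_of_nonpos_right hi hl
    rw [Real.log_div (by positivity) (by positivity)] at h3 ⊢
    rw [one_div, Real.log_inv, en]
    linarith
  rw [Real.exp_neg] at h2
  have hE := Real.exp_pos (n * en ρ)
  have h5 : (Real.exp (n * en ρ))⁻¹ * ((n + i).choose i : ℝ) ≤ 1 := le_trans (by gcongr) h1
  rwa [inv_mul_le_iff₀ hE, mul_one] at h5

lemma en_nonneg {ρ : ℝ} (hρ : 0 < ρ) : 0 ≤ en ρ := by
  have h1 : 0 ≤ Real.log (1 + ρ) := Real.log_nonneg (by linarith)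
  have h2 : Real.log ρ ≤ Real.log (1 + ρ) := Real.log_le_log hρ (by linarith)
  rw [en]; nlinarith

set_option maxHeartbeats 2000000 in
lemma asymp (s c ε : ℝ) (hs0 : 0 < s) (hs1 : s < 1) (hc0 : 0 < c) (hsc : s ^ 2 + c ^ 2 = 1)
    (hε : 0 < ε) : ∃ n₀ : ℕ, ∀ n : ℕ, n₀ ≤ n → ∀ A : Finset (EuclideanSpace ℝ (Fin n)),
        (∀ u ∈ A, ‖u‖ = 1) → (∀ u ∈ A, ∀ v ∈ A, u ≠ v → ⟪u, v⟫ ≤ c) →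
        Real.log (#A : ℝ) ≤ n * (en ((1 - s) / (2 * s)) + ε) := by
  set ρ₀ := (1 - s) / (2 * s) with hρ₀
  have hρ₀pos : 0 < ρ₀ := div_pos (by linarith) (by linarith)
  have hc1 : c < 1 := by nlinarith
  -- choose ρ
  have hcont : ContinuousAt en ρ₀ := by
    unfold en
    have h1 : ContinuousAt Real.log (1 + ρ₀) := Real.continuousAt_log (by positivity)
    have h2 : ContinuousAt Real.log ρ₀ := Real.continuousAt_log (by positivity)
    have h3 : ContinuousAt (fun x : ℝ => Real.log (1 + x)) ρ₀ :=
      ContinuousAt.comp (f := fun x : ℝ => 1 + x) h1 (by fun_prop)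
    fun_prop
  have hev : ∀ᶠ x in nhds ρ₀, en x < en ρ₀ + ε / 2 :=
    hcont.eventually (Iio_mem_nhds (by linarith))
  obtain ⟨ρ, hρen, hρgt⟩ : ∃ ρ, en ρ < en ρ₀ + ε / 2 ∧ ρ₀ < ρ :=
    ((hev.filter_mono nhdsWithin_le_nhds).and (self_mem_nhdsWithin (s := Set.Ioi ρ₀))).exists
  set ρ' := (ρ₀ + ρ) / 2 with hρ'
  have h1' : ρ₀ < ρ' := by linarith
  have h2' : ρ' < ρ := by linarith
  have hρ'pos : 0 < ρ' := by linarith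
  have hρpos : 0 < ρ := by linarith
  set r := √((1 - 1 / (1 + 2 * ρ') ^ 2) / 4) with hr
  have hkey : c ^ 2 < 1 - 1 / (1 + 2 * ρ') ^ 2 := by
    have e : 1 < s * (1 + 2 * ρ') := by
      have : s * (1 + 2 * ρ₀) = 1 := by rw [hρ₀]; field_simp; ring
      nlinarith
    have : 1 / (1 + 2 * ρ') ^ 2 < s ^ 2 := by
      rw [div_lt_iff₀ (by positivity), ← mul_pow]
      nlinarith
    linarith
  have hr2 : r ^ 2 = (1 - 1 / (1 + 2 * ρ') ^ 2) / 4 := Real.sq_sqrt (by nlinarith [sq_nonneg c])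
  have hrpos : 0 < r := Real.sqrt_pos.mpr (by nlinarith [sq_nonneg c])
  have hrc : c < 2 * r := by
    apply lt_of_pow_lt_pow_left₀ 2 (by positivity)
    rw [mul_pow, hr2]; linarith
  -- choose m
  have hlim : Filter.Tendsto (fun m : ℕ => 2 * r * Real.cos (Real.pi / ((m : ℝ) + 1)))
      Filter.atTop (nhds (2 * r * Real.cos 0)) := by
    apply Filter.Tendsto.const_mul
    apply (Real.continuous_cos.tendsto 0).comp
    have := (tendsto_one_div_add_atTop_nhds_zero_nat (𝕜 := ℝ)).const_mul Real.pi
    simpa [div_eq_mul_inv] using this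
  rw [Real.cos_zero, mul_one] at hlim
  obtain ⟨m, hmc, hm1⟩ := ((hlim.eventually (Ioi_mem_nhds hrc)).and
    (Filter.eventually_ge_atTop 1)).exists
  have hmc : c < 2 * r * Real.cos (Real.pi / ((m : ℝ) + 1)) := hmc
  set L := 2 * r * Real.cos (Real.pi / ((m : ℝ) + 1)) with hL
  have hmpos : (0:ℝ) < m := by exact_mod_cast hm1
  set K := (1 - c) * m / (L - c) with hK
  have hLc : 0 < L - c := by linarith
  have hKpos : 0 < K := div_pos (mul_pos (by linarith) hmpos) hLc
  obtain ⟨N1, hN1⟩ := exists_nat_ge ((m + 1) / (ρ - ρ'))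
  obtain ⟨N2, hN2⟩ := exists_nat_ge (Real.log K / (ε / 2))
  refine ⟨max 5 (max N1 N2), fun n hn A hA hin => ?_⟩
  have hn5 : 5 ≤ n := le_trans (le_max_left _ _) hn
  have hnN1 : (N1 : ℝ) ≤ n := by
    exact_mod_cast le_trans (le_trans (le_max_left _ _) (le_max_right _ _)) hn
  have hnN2 : (N2 : ℝ) ≤ n := by
    exact_mod_cast le_trans (le_trans (le_max_right _ _) (le_max_right _ _)) hn
  have hg1 : (m : ℝ) + 1 ≤ n * (ρ - ρ') := by
    rw [← div_le_iff₀ (by linarith)]; exact hN1.trans hnN1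
  have hg2 : Real.log K ≤ n * (ε / 2) := by
    rw [← div_le_iff₀ (by linarith)]; exact hN2.trans hnN2
  have hn0 : (0:ℝ) ≤ n := by positivity
  rcases Nat.eq_zero_or_pos (#A) with hA0 | hA0
  · rw [hA0]; simp only [Nat.cast_zero, Real.log_zero]
    have := en_nonneg hρ₀pos
    positivity
  have hApos : (0:ℝ) < #A := by exact_mod_cast hA0
  set k := ⌊ρ * n⌋₊ with hk
  have hk1 : (k : ℝ) ≤ ρ * n := Nat.floor_le (by positivity)
  have hk2 : ρ * n < k + 1 := Nat.lt_floor_add_one _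
  have hmk : m ≤ k := by
    have : (m : ℝ) ≤ k := by nlinarith [mul_nonneg hn0 hρ'pos.le]
    exact_mod_cast this
  obtain ⟨l, hl⟩ := Nat.exists_eq_add_of_le' hmk
  have hlk : (k : ℝ) = l + m := by rw [hl]; push_cast; rfl
  have hmain := main_bound hn5 l m hm1 r c hrpos hc1.le (fun j hj => by
    rw [hr2]
    apply bc_ge hn5 _ ρ' hρ'pos
    push_cast
    have : (0:ℝ) ≤ j := by positivity
    nlinarith) hmc A hA hin
  have hsum : ∑ j ∈ range m, (n.multichoose (l + j + 1) : ℝ) ≤ m * Real.exp (n * en ρ) := by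
    have := Finset.sum_le_card_nsmul (range m) (fun j => (n.multichoose (l + j + 1) : ℝ))
      (Real.exp (n * en ρ)) (fun j hj => by
        apply multichoose_le hn5 _ ρ hρpos
        refine le_trans ?_ hk1
        have := Finset.mem_range.mp hj
        exact_mod_cast (by omega : l + j + 1 ≤ k))
    simpa using this
  have hA2 : (#A : ℝ) ≤ K * Real.exp (n * en ρ) := by
    rw [hK, div_mul_eq_mul_div, le_div_iff₀ hLc]
    refine hmain.trans ?_
    rw [mul_assoc]
    exact mul_le_mul_of_nonneg_left hsum (by linarith)
  have hlog := Real.log_le_log hApos hA2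
  rw [Real.log_mul hKpos.ne' (Real.exp_pos _).ne', Real.log_exp] at hlog
  have : n * en ρ ≤ n * (en ρ₀ + ε / 2) := mul_le_mul_of_nonneg_left hρen.le hn0
  nlinarith

end KL

/-- **Kabatiansky–Levenstein.** For `0 < θ < π/2` and `ε > 0` there is `n₀`
such that for all `n ≥ n₀`: if `A` is a finite set of unit vectors in `ℝⁿ` with pairwise
inner products at most `cos θ`, then `(1/n)·log₂ #A ≤ g(θ) + ε`, where
`g(θ) = ((1+s)/(2s))·log₂((1+s)/(2s)) − ((1−s)/(2s))·log₂((1−s)/(2s))` and `s = sin θ`. -/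
theorem stmt_5 (θ : ℝ) (hθ₀ : 0 < θ) (hθ₁ : θ < Real.pi / 2) (ε : ℝ) (hε : 0 < ε) :
    ∃ n₀ : ℕ, ∀ n : ℕ, n₀ ≤ n →
      ∀ A : Finset (EuclideanSpace ℝ (Fin n)),
        (∀ u ∈ A, ‖u‖ = 1) →
        (∀ u ∈ A, ∀ v ∈ A, u ≠ v → ⟪u, v⟫ ≤ Real.cos θ) →
        Real.logb 2 (A.card : ℝ) / (n : ℝ) ≤
          ((1 + Real.sin θ) / (2 * Real.sin θ)) *
              Real.logb 2 ((1 + Real.sin θ) / (2 * Real.sin θ)) -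
            ((1 - Real.sin θ) / (2 * Real.sin θ)) *
              Real.logb 2 ((1 - Real.sin θ) / (2 * Real.sin θ)) + ε := by
  have hs0 : 0 < Real.sin θ := Real.sin_pos_of_pos_of_lt_pi hθ₀ (by linarith [Real.pi_pos])
  have hc0 : 0 < Real.cos θ := Real.cos_pos_of_mem_Ioo ⟨by linarith, hθ₁⟩
  have hsc := Real.sin_sq_add_cos_sq θ
  have hs1 : Real.sin θ < 1 := by nlinarith
  have hl2 : 0 < Real.log 2 := Real.log_pos (by norm_num)
  obtain ⟨n₀, h⟩ := KL.asymp (Real.sin θ) (Real.cos θ) (ε * Real.log 2) hs0 hs1 hc0 hsc (by positivity)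
  refine ⟨max 1 n₀, fun n hn A hA hin => ?_⟩
  have h1 := h n (le_trans (le_max_right _ _) hn) A hA hin
  have hn1 : (0:ℝ) < n := by
    exact_mod_cast (lt_of_lt_of_le one_pos (le_trans (le_max_left _ _) hn) : 0 < n)
  have e : 1 + (1 - Real.sin θ) / (2 * Real.sin θ) = (1 + Real.sin θ) / (2 * Real.sin θ) := by
    field_simp; ring
  rw [KL.en, e] at h1
  rw [div_le_iff₀ hn1]
  simp only [Real.logb]
  rw [div_le_iff₀ hl2]
  refine h1.trans_eq ?_
  field_simp
end

section
/- Let E : y² + a₁xy + a₃y = x³ + a₂x² + a₄x + a₆ be an elliptic curve whose coefficients aᵢ lie in the finite field F_q (a constant curve) and whose discriminant is nonzero, regarded as a curve over the rational function field F_q(T). Then every F_q(T)-rational affine point of E has both coordinates in F_q; that is, E(F_q(T)) = E(F_q). -/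
open Polynomial

def FF {R} [CommRing R] (a₁ a₂ a₃ a₄ a₆ X Y Z : R) : R :=
  Y^2*Z+a₁*X*Y*Z+a₃*Y*Z^2-X^3-a₂*X^2*Z-a₄*X*Z^2-a₆*Z^3
def GX {R} [CommRing R] (a₁ a₂ a₄ X Y Z : R) : R :=
  a₁*Y*Z-3*X^2-2*a₂*X*Z-a₄*Z^2
def GY {R} [CommRing R] (a₁ a₃ X Y Z : R) : R := 2*Y*Z+a₁*X*Z+a₃*Z^2
def GZ {R} [CommRing R] (a₁ a₂ a₃ a₄ a₆ X Y Z : R) : R :=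
  Y^2+a₁*X*Y+2*a₃*Y*Z-a₂*X^2-2*a₄*X*Z-3*a₆*Z^2

lemma sing {L} [Field L] {a₁ a₂ a₃ a₄ a₆ X Y Z : L}
    (hΔ : (⟨a₁,a₂,a₃,a₄,a₆⟩ : WeierstrassCurve L).Δ ≠ 0)
    (hF : FF a₁ a₂ a₃ a₄ a₆ X Y Z = 0) (hX : GX a₁ a₂ a₄ X Y Z = 0)
    (hY : GY a₁ a₃ X Y Z = 0) (hZ : GZ a₁ a₂ a₃ a₄ a₆ X Y Z = 0) : X = 0 ∧ Y = 0 ∧ Z = 0 := by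
  unfold FF at hF
  unfold GX at hX
  unfold GY at hY
  unfold GZ at hZ
  by_cases h : Z = 0
  · subst h
    have : X = 0 := by simpa using hF
    subst this
    simpa using hZ
  · exfalso
    have e : WeierstrassCurve.Affine.Equation (⟨a₁,a₂,a₃,a₄,a₆⟩ : WeierstrassCurve L) (X/Z) (Y/Z) := by
      rw [WeierstrassCurve.Affine.equation_iff]
      field_simp
      linear_combination hF
    have := (WeierstrassCurve.Affine.equation_iff_nonsingular_of_Δ_ne_zero hΔ).1 e
    rw [WeierstrassCurve.Affine.nonsingular_iff'] at this
    rcases this.2 with h1 | h1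
    · apply h1
      field_simp
      linear_combination hX
    · apply h1
      field_simp
      apply mul_left_cancel₀ h
      linear_combination hY

lemma coeff3 {K} [Field K] {n : ℕ} {X Y Z : K[X]} (hX : X.natDegree ≤ n) (hY : Y.natDegree ≤ n)
   (hZ : Z.natDegree ≤ n) : (X*Y*Z).coeff (n+n+n) = X.coeff n * Y.coeff n * Z.coeff n := by
  rw [coeff_mul_add_eq_of_natDegree_le (natDegree_mul_le_of_le hX hY) hZ,
    coeff_mul_add_eq_of_natDegree_le hX hY]

lemma bez {R} [CommRing R] {g1 g2 g3 w1 w2 w3 : R} (h : Ideal.span {g1,g2,g3} = ⊤)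
   (h12 : w1*g2 = w2*g1) (h13 : w1*g3 = w3*g1) (h23 : w2*g3=w3*g2) :
   ∃ k, w1 = g1*k ∧ w2 = g2*k ∧ w3 = g3*k := by
  have : (1:R) ∈ Ideal.span {g1,g2,g3} := by rw [h]; trivial
  rw [Ideal.mem_span_insert'] at this
  obtain ⟨a, ha⟩ := this
  rw [Ideal.mem_span_pair] at ha
  obtain ⟨b, c, e⟩ := ha
  refine ⟨-a*w1+b*w2+c*w3, ?_, ?_, ?_⟩
  · linear_combination -w1*e+b*h12+c*h13
  · linear_combination -w2*e+a*h12+c*h23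
  · linear_combination -w3*e+a*h13-b*h23
 
lemma primφ {K L} [Field K] [Field L] (ψ : K[X] →+* L) {a₁ a₂ a₃ a₄ a₆ : K} {X Y Z : K[X]}
    (hΔ : (⟨a₁,a₂,a₃,a₄,a₆⟩ : WeierstrassCurve K).Δ ≠ 0)
    (m0 : ψ (FF (C a₁) (C a₂) (C a₃) (C a₄) (C a₆) X Y Z) = 0)
    (m1 : ψ (GX (C a₁) (C a₂) (C a₄) X Y Z) = 0)
    (m2 : ψ (GY (C a₁) (C a₃) X Y Z) = 0)
    (m3 : ψ (GZ (C a₁) (C a₂) (C a₃) (C a₄) (C a₆) X Y Z) = 0) :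
    ψ X = 0 ∧ ψ Y = 0 ∧ ψ Z = 0 := by
  let φ : K →+* L := ψ.comp C
  have hd : (⟨φ a₁,φ a₂,φ a₃,φ a₄,φ a₆⟩ : WeierstrassCurve L).Δ ≠ 0 := by
    have := WeierstrassCurve.map_Δ (⟨a₁,a₂,a₃,a₄,a₆⟩ : WeierstrassCurve K) φ
    intro h
    exact hΔ (φ.injective (by rw [← this, map_zero]; exact h))
  have e2 : ψ 2 = 2 := map_ofNat ψ 2
  have e3 : ψ 3 = 3 := map_ofNat ψ 3
  exact sing hd (by simpa [FF, φ] using m0) (by simpa [GX, φ, e2, e3] using m1)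
    (by simpa [GY, φ, e2, e3] using m2) (by simpa [GZ, φ, e2, e3] using m3)

lemma prim {K} [Field K] {a₁ a₂ a₃ a₄ a₆ : K} {X Y Z : K[X]}
    (hΔ : (⟨a₁,a₂,a₃,a₄,a₆⟩ : WeierstrassCurve K).Δ ≠ 0)
    (hF : FF (C a₁) (C a₂) (C a₃) (C a₄) (C a₆) X Y Z = 0)
    (hp : Ideal.span {X,Y,Z} = ⊤) :
    Ideal.span {GX (C a₁) (C a₂) (C a₄) X Y Z, GY (C a₁) (C a₃) X Y Z,
      GZ (C a₁) (C a₂) (C a₃) (C a₄) (C a₆) X Y Z} = ⊤ := by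
  by_contra hne
  obtain ⟨M, hM, hle⟩ := Ideal.exists_le_maximal _ hne
  letI := Ideal.Quotient.field M
  rw [Ideal.span_le] at hle
  have m1 := Ideal.Quotient.eq_zero_iff_mem.2 (hle (by simp : GX (C a₁) (C a₂) (C a₄) X Y Z ∈ _))
  have m2 := Ideal.Quotient.eq_zero_iff_mem.2 (hle (by simp : GY (C a₁) (C a₃) X Y Z ∈ _))
  have m3 := Ideal.Quotient.eq_zero_iff_mem.2
    (hle (by simp : GZ (C a₁) (C a₂) (C a₃) (C a₄) (C a₆) X Y Z ∈ _))
  have m0 := congrArg (Ideal.Quotient.mk M) hF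
  rw [map_zero] at m0
  obtain ⟨hx, hy, hz⟩ := primφ (Ideal.Quotient.mk M) hΔ m0 m1 m2 m3
  rw [Ideal.Quotient.eq_zero_iff_mem] at hx hy hz
  apply hM.ne_top
  rw [eq_top_iff, ← hp, Ideal.span_le]
  rintro t (rfl|rfl|rfl) <;> assumption

lemma at_infty {K} [Field K] {a₁ a₂ a₃ a₄ a₆ : K} {X Y Z : K[X]} {n : ℕ}
    (hΔ : (⟨a₁,a₂,a₃,a₄,a₆⟩ : WeierstrassCurve K).Δ ≠ 0)
    (hF : FF (C a₁) (C a₂) (C a₃) (C a₄) (C a₆) X Y Z = 0)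
    (hX : X.natDegree ≤ n) (hY : Y.natDegree ≤ n) (hZ : Z.natDegree ≤ n)
    (h1 : (GX (C a₁) (C a₂) (C a₄) X Y Z).coeff (n+n) = 0)
    (h2 : (GY (C a₁) (C a₃) X Y Z).coeff (n+n) = 0)
    (h3 : (GZ (C a₁) (C a₂) (C a₃) (C a₄) (C a₆) X Y Z).coeff (n+n) = 0) :
    X.coeff n = 0 ∧ Y.coeff n = 0 ∧ Z.coeff n = 0 := by
  have h0 := congrArg (fun f => f.coeff (n+n+n)) hF
  have e2 : (2:K[X]) = C 2 := (map_ofNat C 2).symm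
  have e3 : (3:K[X]) = C 3 := (map_ofNat C 3).symm
  simp only [FF, GX, GY, GZ, pow_succ, pow_zero, one_mul, mul_assoc, e2, e3, coeff_sub,
    coeff_add, coeff_C_mul, coeff_zero] at h0 h1 h2 h3
  simp only [← mul_assoc, coeff3, hX, hY, hZ, coeff_mul_add_eq_of_natDegree_le] at h0 h1 h2 h3
  apply sing hΔ
  · rw [← h0]; unfold FF; ring
  · rw [← h1]; unfold GX; ring
  · rw [← h2]; unfold GY; ring
  · rw [← h3]; unfold GZ; ring

lemma wdeg {K} [Field K] {X Y : K[X]} {n : ℕ} (hX : X.natDegree ≤ n) (hY : Y.natDegree ≤ n)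
    (m : ℕ) (hm : n + n ≤ m) :
    (X * derivative Y - Y * derivative X).coeff m = 0 := by
  rcases Nat.eq_zero_or_pos n with h | h
  · rw [derivative_of_natDegree_zero (by omega), derivative_of_natDegree_zero (by omega)]; simp
  · apply coeff_eq_zero_of_natDegree_lt
    have h1 := natDegree_derivative_le X
    have h2 := natDegree_derivative_le Y
    have h3 := natDegree_sub_le (X * derivative Y) (Y * derivative X)
    have h4 := natDegree_mul_le (p := X) (q := derivative Y)
    have h5 := natDegree_mul_le (p := Y) (q := derivative X)
    omega

lemma kz {K} [Field K] {g w k : K[X]} {m : ℕ} (hw : w = g * k) (h : ∀ i, m ≤ i → w.coeff i = 0)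
    (hg : g.coeff m ≠ 0) : k = 0 := by
  by_contra hk
  have g0 : g ≠ 0 := by rintro rfl; simp at hg
  have : w ≠ 0 := by rw [hw]; exact mul_ne_zero g0 hk
  apply this
  rw [← leadingCoeff_eq_zero]
  apply h
  rw [hw, natDegree_mul g0 hk]
  have := le_natDegree_of_ne_zero hg
  omega

lemma der {K} [Field K] {a₁ a₂ a₃ a₄ a₆ : K} {X Y Z : K[X]}
    (hΔ : (⟨a₁,a₂,a₃,a₄,a₆⟩ : WeierstrassCurve K).Δ ≠ 0)
    (hF : FF (C a₁) (C a₂) (C a₃) (C a₄) (C a₆) X Y Z = 0)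
    (hp : Ideal.span {X,Y,Z} = ⊤) :
    derivative X = 0 ∧ derivative Y = 0 ∧ derivative Z = 0 := by
  have hpg := prim hΔ hF hp
  have hd := congrArg derivative hF
  have eul : X * GX (C a₁) (C a₂) (C a₄) X Y Z + Y * GY (C a₁) (C a₃) X Y Z
     + Z * GZ (C a₁) (C a₂) (C a₃) (C a₄) (C a₆) X Y Z = 0 := by
    rw [← mul_zero 3, ← hF]; unfold FF GX GY GZ; ring
  have dd : derivative X * GX (C a₁) (C a₂) (C a₄) X Y Z + derivative Y * GY (C a₁) (C a₃) X Y Z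
     + derivative Z * GZ (C a₁) (C a₂) (C a₃) (C a₄) (C a₆) X Y Z = 0 := by
    rw [derivative_zero] at hd
    rw [← hd]; unfold FF GX GY GZ
    have e2 : (C 2 : K[X]) = 2 := map_ofNat C 2
    have e3 : (C 3 : K[X]) = 3 := map_ofNat C 3
    simp [derivative_pow, derivative_mul, e2, e3]
    ring
  obtain ⟨n, hX, hY, hZ, hn⟩ : ∃ n, X.natDegree ≤ n ∧ Y.natDegree ≤ n ∧ Z.natDegree ≤ n ∧
      (n = X.natDegree ∨ n = Y.natDegree ∨ n = Z.natDegree) :=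
    ⟨max X.natDegree (max Y.natDegree Z.natDegree), by omega, by omega, by omega, by omega⟩
  have hI := at_infty (n := n) hΔ hF hX hY hZ
  generalize GX (C a₁) (C a₂) (C a₄) X Y Z = g1 at *
  generalize GY (C a₁) (C a₃) X Y Z = g2 at *
  generalize GZ (C a₁) (C a₂) (C a₃) (C a₄) (C a₆) X Y Z = g3 at *
  obtain ⟨k, k1, k2, k3⟩ := bez (w1 := Y * derivative Z - Z * derivative Y)
    (w2 := Z * derivative X - X * derivative Z) (w3 := X * derivative Y - Y * derivative X) hpg
    (by linear_combination derivative Z * eul - Z * dd)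
    (by linear_combination Y * dd - derivative Y * eul)
    (by linear_combination derivative X * eul - X * dd)
  have nz : ¬ (X.coeff n = 0 ∧ Y.coeff n = 0 ∧ Z.coeff n = 0) := by
    rintro ⟨hx, hy, hz⟩
    have h0 : X = 0 ∨ Y = 0 ∨ Z = 0 := by
      rcases hn with rfl | rfl | rfl
      · left; simpa using hx
      · right; left; simpa using hy
      · right; right; simpa using hz
    have hn0 : X = 0 ∧ Y = 0 ∧ Z = 0 := by
      have key : ∀ V : K[X], V.natDegree ≤ n → V.coeff n = 0 → V = 0 ∨ V.natDegree < n := by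
        intro V h1 h2
        by_contra! h
        apply h.1
        rw [← leadingCoeff_eq_zero, leadingCoeff, le_antisymm h1 h.2, h2]
      have c1 := key X hX hx
      have c2 := key Y hY hy
      have c3 := key Z hZ hz
      have hn' : n = 0 := by
        rcases hn with h | h | h
        · rcases c1 with c | c
          · simpa [c] using h
          · omega
        · rcases c2 with c | c
          · simpa [c] using h
          · omega
        · rcases c3 with c | c
          · simpa [c] using h
          · omega
      subst hn'
      simpa using And.intro c1 (And.intro c2 c3)
    obtain ⟨rfl, rfl, rfl⟩ := hn0
    simp at hp
  have k0 : k = 0 := by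
    by_contra hk
    apply nz
    apply hI
    · by_contra h; exact hk (kz k1 (wdeg hY hZ) h)
    · by_contra h; exact hk (kz k2 (wdeg hZ hX) h)
    · by_contra h; exact hk (kz k3 (wdeg hX hY) h)
  subst k0
  obtain ⟨k, d1, d2, d3⟩ := bez (w1 := derivative X) (w2 := derivative Y) (w3 := derivative Z) hp
    (by linear_combination -k3) (by linear_combination k2) (by linear_combination -k1)
  have fin : ∀ V : K[X], derivative V = V * k → derivative V = 0 := by
    intro V h
    by_contra h0
    have hk : k ≠ 0 := by rintro rfl; simp [h] at h0
    have hV : V ≠ 0 := by rintro rfl; simp at h0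
    have h1 : V.natDegree ≠ 0 := fun h => h0 (derivative_of_natDegree_zero h)
    have := natDegree_derivative_lt h1
    rw [h, natDegree_mul hV hk] at this
    omega
  exact ⟨fin _ d1, fin _ d2, fin _ d3⟩

lemma pth {K} [Field K] (p : ℕ) [Fact p.Prime] [CharP K p] [PerfectRing K p] (f : K[X])
    (h : derivative f = 0) : ∃ g : K[X], f = g ^ p := by
  refine ⟨(contract p f).map (frobeniusEquiv K p).symm, ?_⟩
  rw [← map_frobenius_expand (R := K) p, map_expand, Polynomial.map_map]
  have : (frobenius K p).comp ((frobeniusEquiv K p).symm : K →+* K) = RingHom.id K := by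
    ext x; simp
  rw [this, Polynomial.map_id, expand_contract p h (Fact.out : p.Prime).ne_zero]

lemma main_descent {K} [Field K] (p : ℕ) [Fact p.Prime] [CharP K p] [PerfectRing K p] (N : ℕ) :
    ∀ (a₁ a₂ a₃ a₄ a₆ : K) (X Y Z : K[X]),
    X.natDegree + Y.natDegree + Z.natDegree = N → 
    (⟨a₁,a₂,a₃,a₄,a₆⟩ : WeierstrassCurve K).Δ ≠ 0 → 
    FF (C a₁) (C a₂) (C a₃) (C a₄) (C a₆) X Y Z = 0 → 
    ¬ (X = 0 ∧ Y = 0 ∧ Z = 0) →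
    ∃ (g : K[X]) (x y z : K), X = g * C x ∧ Y = g * C y ∧ Z = g * C z := by
  induction N using Nat.strong_induction_on with
  | _ N ih =>
  intro a₁ a₂ a₃ a₄ a₆ X Y Z hN hΔ hF h0
  by_cases hN0 : N = 0
  · refine ⟨1, X.coeff 0, Y.coeff 0, Z.coeff 0, ?_, ?_, ?_⟩ <;> rw [one_mul]
    · exact eq_C_of_natDegree_eq_zero (by omega)
    · exact eq_C_of_natDegree_eq_zero (by omega)
    · exact eq_C_of_natDegree_eq_zero (by omega)
  by_cases hp : Ideal.span {X,Y,Z} = ⊤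
  · obtain ⟨d1, d2, d3⟩ := der hΔ hF hp
    obtain ⟨X, rfl⟩ := pth p X d1
    obtain ⟨Y, rfl⟩ := pth p Y d2
    obtain ⟨Z, rfl⟩ := pth p Z d3
    have hp2 : 2 ≤ p := (Fact.out : p.Prime).two_le
    simp only [natDegree_pow] at hN
    obtain ⟨a₁, rfl⟩ := (frobeniusEquiv K p).surjective a₁
    obtain ⟨a₂, rfl⟩ := (frobeniusEquiv K p).surjective a₂
    obtain ⟨a₃, rfl⟩ := (frobeniusEquiv K p).surjective a₃
    obtain ⟨a₄, rfl⟩ := (frobeniusEquiv K p).surjective a₄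
    obtain ⟨a₆, rfl⟩ := (frobeniusEquiv K p).surjective a₆
    simp only [frobeniusEquiv_apply, frobenius_def] at *
    obtain ⟨g, x, y, z, rfl, rfl, rfl⟩ := ih (X.natDegree + Y.natDegree + Z.natDegree)
      (by nlinarith [Nat.pos_of_ne_zero hN0]) a₁ a₂ a₃ a₄ a₆ X Y Z rfl (by
        have := WeierstrassCurve.map_Δ (⟨a₁,a₂,a₃,a₄,a₆⟩ : WeierstrassCurve K) (frobenius K p)
        intro h
        rw [h, map_zero] at this
        exact hΔ this) (by
        have : (FF (C a₁) (C a₂) (C a₃) (C a₄) (C a₆) X Y Z)^p = 0 := by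
          rw [← hF, ← frobenius_def]
          simp only [FF, map_sub, map_add, map_mul, map_pow, frobenius_def]
        exact pow_eq_zero_iff (by omega) |>.1 this) (by
        rintro ⟨rfl, rfl, rfl⟩
        exact h0 (by simp; omega))
    exact ⟨g^p, x^p, y^p, z^p, by simp [mul_pow], by simp [mul_pow], by simp [mul_pow]⟩
  · obtain ⟨d, hd⟩ := IsPrincipalIdealRing.principal (Ideal.span {X,Y,Z})
    rw [Ideal.submodule_span_eq] at hd
    have hdu : ¬ IsUnit d := fun h => hp (by rw [hd, Ideal.span_singleton_eq_top]; exact h)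
    have hdv : ∀ V ∈ Ideal.span {X,Y,Z}, d ∣ V := by
      intro V hV
      rwa [hd, Ideal.mem_span_singleton] at hV
    obtain ⟨X', hX⟩ := hdv X (Ideal.subset_span (by simp))
    obtain ⟨Y', hY⟩ := hdv Y (Ideal.subset_span (by simp))
    obtain ⟨Z', hZ⟩ := hdv Z (Ideal.subset_span (by simp))
    clear hd hdv hp
    subst hX hY hZ
    have hd0 : d ≠ 0 := by rintro rfl; simp at h0
    have hdd : 0 < d.natDegree := natDegree_pos_iff_degree_pos.2 (degree_pos_of_ne_zero_of_nonunit hd0 hdu)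
    have h0' : ¬ (X' = 0 ∧ Y' = 0 ∧ Z' = 0) := by rintro ⟨rfl, rfl, rfl⟩; simp at h0
    have key : ∀ V : K[X], (V = 0 ∧ (d*V).natDegree = V.natDegree) ∨
       (V.natDegree < (d*V).natDegree) := by
      intro V
      by_cases hV : V = 0
      · left; simp [hV]
      · right; rw [natDegree_mul hd0 hV]; omega
    obtain ⟨g, x, y, z, rfl, rfl, rfl⟩ := ih (X'.natDegree + Y'.natDegree + Z'.natDegree)
      (by
        have := key X'
        have := key Y'
        have := key Z'
        by_contra hlt
        apply h0'
        refine ⟨?_, ?_, ?_⟩ <;> by_contra h <;> simp [h] at * <;> omega) a₁ a₂ a₃ a₄ a₆ X' Y' Z' rfl hΔ (by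
        have : d^3 * FF (C a₁) (C a₂) (C a₃) (C a₄) (C a₆) X' Y' Z' = 0 := by
          rw [← hF]; unfold FF; ring
        exact (mul_eq_zero.1 this).resolve_left (pow_ne_zero _ hd0)) h0'
    exact ⟨d*g, x, y, z, by ring, by ring, by ring⟩

/-- Let `E : y² + a₁xy + a₃y = x³ + a₂x² + a₄x + a₆` be an elliptic
curve whose coefficients lie in the finite field `F_q` (a constant curve), with nonzero
discriminant, regarded as a curve over `F_q(T)`. Then every `F_q(T)`-rational affine
point of `E` has both coordinates in `F_q`; that is, `E(F_q(T)) = E(F_q)`. -/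
theorem stmt_11 {Fq : Type*} [Field Fq] [Fintype Fq]
    (a₁ a₂ a₃ a₄ a₆ : Fq)
    (E : WeierstrassCurve.Affine (RatFunc Fq))
    (hE : E = ⟨algebraMap Fq (RatFunc Fq) a₁, algebraMap Fq (RatFunc Fq) a₂,
      algebraMap Fq (RatFunc Fq) a₃, algebraMap Fq (RatFunc Fq) a₄,
      algebraMap Fq (RatFunc Fq) a₆⟩)
    (hΔ : E.Δ ≠ 0) :
    ∀ x y : RatFunc Fq, E.Nonsingular x y →
      (∃ x₀ : Fq, x = algebraMap Fq (RatFunc Fq) x₀) ∧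
        (∃ y₀ : Fq, y = algebraMap Fq (RatFunc Fq) y₀) := by
  intro x y hxy
  subst hE
  have hd : (⟨a₁,a₂,a₃,a₄,a₆⟩ : WeierstrassCurve Fq).Δ ≠ 0 := by
    have := WeierstrassCurve.map_Δ (⟨a₁,a₂,a₃,a₄,a₆⟩ : WeierstrassCurve Fq)
      (algebraMap Fq (RatFunc Fq))
    intro h
    rw [h, map_zero] at this
    exact hΔ this
  obtain ⟨p, hp⟩ := CharP.exists Fq
  haveI : Fact p.Prime := ⟨CharP.char_is_prime Fq p⟩
  have heq := hxy.1
  rw [WeierstrassCurve.Affine.equation_iff] at heq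
  have hx := RatFunc.num_div_denom x
  have hy := RatFunc.num_div_denom y
  have hx0 := RatFunc.denom_ne_zero x
  have hy0 := RatFunc.denom_ne_zero y
  generalize x.num = A at *
  generalize y.num = B at *
  generalize x.denom = D at *
  generalize y.denom = G at *
  have hD : algebraMap Fq[X] (RatFunc Fq) D ≠ 0 := by simpa using hx0
  have hG : algebraMap Fq[X] (RatFunc Fq) G ≠ 0 := by simpa using hy0
  have hC : ∀ c, algebraMap Fq (RatFunc Fq) c = algebraMap Fq[X] (RatFunc Fq) (C c) := by
    intro c; rw [IsScalarTower.algebraMap_apply Fq Fq[X] (RatFunc Fq)]; rfl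
  obtain ⟨g, u, v, w, h1, h2, h3⟩ := main_descent p _ a₁ a₂ a₃ a₄ a₆ (A*G) (B*D) (D*G) rfl hd (by
    apply RatFunc.algebraMap_injective Fq
    simp only [FF, map_sub, map_add, map_mul, map_pow, ← hC, map_zero]
    rw [← hx, ← hy] at heq
    field_simp at heq
    linear_combination (algebraMap Fq[X] (RatFunc Fq) G) * heq) (by simp [hx0, hy0])
  have hgw : g * C w ≠ 0 := by rw [← h3]; exact mul_ne_zero hx0 hy0
  have hg : algebraMap Fq[X] (RatFunc Fq) g ≠ 0 := by simpa using left_ne_zero_of_mul hgw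
  have hw : algebraMap Fq (RatFunc Fq) w ≠ 0 := by
    have := right_ne_zero_of_mul hgw
    simpa using this
  replace h1 := congrArg (algebraMap Fq[X] (RatFunc Fq)) h1
  replace h2 := congrArg (algebraMap Fq[X] (RatFunc Fq)) h2
  replace h3 := congrArg (algebraMap Fq[X] (RatFunc Fq)) h3
  simp only [map_mul, ← hC] at h1 h2 h3
  constructor
  · refine ⟨u / w, ?_⟩
    rw [← hx, map_div₀, div_eq_div_iff hD hw]
    apply mul_right_cancel₀ (mul_ne_zero hG hg)
    linear_combination (algebraMap Fq (RatFunc Fq) w) * (algebraMap Fq[X] (RatFunc Fq) g) * h1 - (algebraMap Fq (RatFunc Fq) u) * (algebraMap Fq[X] (RatFunc Fq) g) * h3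
  · refine ⟨v / w, ?_⟩
    rw [← hy, map_div₀, div_eq_div_iff hG hw]
    apply mul_right_cancel₀ (mul_ne_zero hD hg)
    linear_combination (algebraMap Fq (RatFunc Fq) w) * (algebraMap Fq[X] (RatFunc Fq) g) * h2 - (algebraMap Fq (RatFunc Fq) v) * (algebraMap Fq[X] (RatFunc Fq) g) * h3
end
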